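/- arXiv:1407.8170 — 2 statements merged into one kernel-verified Lean document; each statement's English description precedes it below -/
import Mathlib

section
/- For every instance of the asymmetric binary matrix partition problem there exists a partition scheme B attaining the maximum partition value and additionally satisfying the following property (P5): for every column j and every row i such that A^B_{ij} = max_{i'} A^B_{i'j} and A_{ij} = 1, the bundle of B_i containing j is not mixed. -/
open Finset

structure PartitionScheme (n m : ℕ) where
  bundle : Fin n → Fin m → Finset (Fin m)
  mem_bundle : ∀ i j, j ∈ bundle i j
  consistent : ∀ i j j', j' ∈ bundle i j → bundle i j' = bundle i j

noncomputable def smoothValue {n m : ℕ} (A : Fin n → Fin m → ℝ) (p : Fin m → ℝ)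
    (B : PartitionScheme n m) (i : Fin n) (j : Fin m) : ℝ :=
  (∑ ℓ ∈ B.bundle i j, p ℓ * A i ℓ) / ∑ ℓ ∈ B.bundle i j, p ℓ

noncomputable def partitionValue {n m : ℕ} (A : Fin n → Fin m → ℝ) (p : Fin m → ℝ)
    (B : PartitionScheme n m) : ℝ :=
  ∑ j, p j * ⨆ i, smoothValue A p B i j

/-- A bundle `b` is mixed in row `i` if it contains both a 1-entry and a 0-entry of row `i`. -/
def MixedBundle {n m : ℕ} (A : Fin n → Fin m → ℝ) (i : Fin n) (b : Finset (Fin m)) : Prop :=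
  (∃ j ∈ b, A i j = 1) ∧ (∃ j ∈ b, A i j = 0)

/-- `B` fully covers the set of one-columns. -/
def FullyCovers {n m : ℕ} (A : Fin n → Fin m → ℝ) (B : PartitionScheme n m) : Prop :=
  ∀ j : Fin m, (∃ i, A i j = 1) → ∃ i, A i j = 1 ∧ B.bundle i j = {j}

open scoped Classical in
noncomputable def mixedOneAppearances {n m : ℕ} (A : Fin n → Fin m → ℝ)
    (B : PartitionScheme n m) : ℕ :=
  ∑ i, ∑ b ∈ (Finset.univ.image (B.bundle i)).filter (MixedBundle A i),
    (b.filter (fun j => A i j = 1)).card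

namespace PartitionScheme

variable {n m : ℕ}

instance : Finite (PartitionScheme n m) :=
  Finite.of_injective PartitionScheme.bundle fun B B' h => by
    cases B; cases B'; simpa using h

instance : Nonempty (PartitionScheme n m) :=
  ⟨⟨fun _ j => {j}, by simp, by simp⟩⟩

theorem mem_bundle_comm (B : PartitionScheme n m) {i : Fin n} {j k : Fin m} :
    j ∈ B.bundle i k ↔ k ∈ B.bundle i j :=
  ⟨fun h => B.consistent i k j h ▸ B.mem_bundle i k,
    fun h => B.consistent i j k h ▸ B.mem_bundle i j⟩

/-- Isolate column `j` in row `i`, removing it from its bundle. -/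
def isolate (B : PartitionScheme n m) (i : Fin n) (j : Fin m) : PartitionScheme n m where
  bundle i' l :=
    if i' = i then if l = j then {j} else (B.bundle i l).erase j else B.bundle i' l
  mem_bundle i' l := by
    have := B.mem_bundle i' l
    split_ifs with h₁ h₂ <;> simp_all
  consistent i' l l' h := by
    have := B.consistent i' l l'
    split_ifs at h ⊢ <;> simp_all

theorem isolate_bundle_self (B : PartitionScheme n m) (i : Fin n) (j : Fin m) :
    (B.isolate i j).bundle i j = {j} := by
  simp [isolate]

theorem isolate_bundle_of_col_ne (B : PartitionScheme n m) (i : Fin n) {j l : Fin m}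
    (h : l ≠ j) : (B.isolate i j).bundle i l = (B.bundle i l).erase j := by
  simp [isolate, h]

theorem isolate_bundle_of_row_ne (B : PartitionScheme n m) {i i' : Fin n} (j l : Fin m)
    (h : i' ≠ i) : (B.isolate i j).bundle i' l = B.bundle i' l := by
  simp [isolate, h]

theorem isolate_bundle_subset (B : PartitionScheme n m) (i i' : Fin n) (j l : Fin m) :
    (B.isolate i j).bundle i' l ⊆ B.bundle i' l := by
  by_cases h : i' = i
  · subst h
    by_cases hl : l = j
    · subst hl
      simpa [isolate_bundle_self] using B.mem_bundle i' l
    · rw [isolate_bundle_of_col_ne B i' hl]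
      exact erase_subset _ _
  · rw [isolate_bundle_of_row_ne B j l h]

/-- The total size of the bundles, each counted once per column it contains. -/
def totalBundleCard (B : PartitionScheme n m) : ℕ :=
  ∑ i, ∑ j, (B.bundle i j).card

theorem totalBundleCard_isolate_lt (B : PartitionScheme n m) {i : Fin n} {j k : Fin m}
    (hk : k ∈ B.bundle i j) (hkj : k ≠ j) :
    (B.isolate i j).totalBundleCard < B.totalBundleCard := by
  have hle i' l := card_le_card (B.isolate_bundle_subset i i' j l)
  refine sum_lt_sum (fun i' _ => sum_le_sum fun l _ => hle i' l)
    ⟨i, mem_univ i, sum_lt_sum (fun l _ => hle i l) ⟨j, mem_univ j, ?_⟩⟩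
  rw [isolate_bundle_self, card_singleton, one_lt_card]
  exact ⟨k, hk, j, B.mem_bundle i j, hkj⟩

end PartitionScheme

section SmoothValue

variable {n m : ℕ} {A : Fin n → Fin m → ℝ} {p : Fin m → ℝ}

/-- Smoothing a row preserves its expectation. -/
theorem sum_mul_smoothValue (hp : ∀ j, 0 ≤ p j) (B : PartitionScheme n m) (i : Fin n) :
    ∑ j, p j * smoothValue A p B i j = ∑ j, p j * A i j := by
  have hswap : ∑ j, p j * smoothValue A p B i j =
      ∑ k, ∑ j ∈ B.bundle i k, p j * (p k * A i k / ∑ l ∈ B.bundle i k, p l) := by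
    simp only [smoothValue, sum_div, mul_sum]
    rw [sum_comm' (t' := univ) (s' := fun k => B.bundle i k)
      (fun j k => by simp [B.mem_bundle_comm])]
    refine sum_congr rfl fun k _ => sum_congr rfl fun j hj => ?_
    rw [B.consistent i k j hj]
  rw [hswap]
  refine sum_congr rfl fun k _ => ?_
  rw [← sum_mul]
  by_cases hT : ∑ l ∈ B.bundle i k, p l = 0
  · have hk : p k = 0 :=
      (sum_eq_zero_iff_of_nonneg fun l _ => hp l).1 hT k (B.mem_bundle i k)
    simp [hk]
  · exact mul_div_cancel₀ _ hT

theorem smoothValue_isolate_of_row_ne (B : PartitionScheme n m) {i i' : Fin n} (j l : Fin m)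
    (h : i' ≠ i) : smoothValue A p (B.isolate i j) i' l = smoothValue A p B i' l := by
  simp only [smoothValue, B.isolate_bundle_of_row_ne j l h]

theorem smoothValue_isolate_le (hA : ∀ i j, A i j ∈ Set.Icc 0 1) (hp : ∀ j, 0 ≤ p j)
    (B : PartitionScheme n m) {i : Fin n} {j l : Fin m} (h : l ≠ j) (hj : A i j = 1) :
    smoothValue A p (B.isolate i j) i l ≤ smoothValue A p B i l := by
  simp only [smoothValue, B.isolate_bundle_of_col_ne i h]
  by_cases hjl : j ∈ B.bundle i l
  · rw [← add_sum_erase _ (fun k => p k * A i k) hjl, ← add_sum_erase _ p hjl, hj, mul_one]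
    have hST : ∑ k ∈ (B.bundle i l).erase j, p k * A i k ≤ ∑ k ∈ (B.bundle i l).erase j, p k :=
      sum_le_sum fun k _ => mul_le_of_le_one_right (hp k) (hA i k).2
    have hS : 0 ≤ ∑ k ∈ (B.bundle i l).erase j, p k * A i k :=
      sum_nonneg fun k _ => mul_nonneg (hp k) (hA i k).1
    have hpj := hp j
    generalize ∑ k ∈ (B.bundle i l).erase j, p k * A i k = S at *
    generalize ∑ k ∈ (B.bundle i l).erase j, p k = T at *
    rcases (hS.trans hST).eq_or_lt with hT | hT
    · rw [← hT, div_zero]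
      positivity
    · rw [div_le_div_iff₀ hT (by positivity)]
      nlinarith
  · rw [erase_eq_of_notMem hjl]

/-- Isolating a one-entry that attains the maximum of its column does not decrease the value. -/
theorem partitionValue_le_isolate (hA : ∀ i j, A i j ∈ Set.Icc 0 1) (hp : ∀ j, 0 ≤ p j)
    (B : PartitionScheme n m) {i : Fin n} {j : Fin m} (hj : A i j = 1)
    (hmax : ∀ i', smoothValue A p B i' j ≤ smoothValue A p B i j) :
    partitionValue A p B ≤ partitionValue A p (B.isolate i j) := by
  have : Nonempty (Fin n) := ⟨i⟩
  have hsup i' l : smoothValue A p (B.isolate i j) i' l ≤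
      ⨆ r, smoothValue A p (B.isolate i j) r l :=
    le_ciSup (f := fun r => smoothValue A p (B.isolate i j) r l)
      (Set.finite_range _).bddAbove i'
  have hcol l : (⨆ r, smoothValue A p B r l) ≤ (⨆ r, smoothValue A p (B.isolate i j) r l) +
      (smoothValue A p B i l - smoothValue A p (B.isolate i j) i l) := by
    refine ciSup_le fun r => ?_
    by_cases hl : l = j
    · subst hl
      linarith [hmax r, hsup i l]
    · by_cases hr : r = i
      · subst hr
        linarith [hsup r l]
      · linarith [smoothValue_isolate_le hA hp B hl hj, hsup r l,
          smoothValue_isolate_of_row_ne (A := A) (p := p) B j l hr]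
  have hsum := sum_le_sum fun l (_ : l ∈ univ) => mul_le_mul_of_nonneg_left (hcol l) (hp l)
  simp only [mul_add, mul_sub, sum_add_distrib, sum_sub_distrib, sum_mul_smoothValue hp,
    sub_self, add_zero] at hsum
  exact hsum

end SmoothValue

/-- For every instance there is an optimal partition scheme B such that,
whenever a column j contributes to the partition value through a row i with A_{ij} = 1
(i.e. the smooth value of j in row i is maximal), the bundle of B_i containing j
is not mixed (property P5). -/
theorem exists_optimal_scheme_P5 {n m : ℕ} (hn : 0 < n) (hm : 0 < m)
    (A : Fin n → Fin m → ℝ) (hA : ∀ i j, A i j = 0 ∨ A i j = 1)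
    (p : Fin m → ℝ) (hp : ∀ j, 0 ≤ p j) (hp1 : (∑ j, p j) = 1) :
    ∃ B : PartitionScheme n m,
      (∀ B' : PartitionScheme n m, partitionValue A p B' ≤ partitionValue A p B) ∧
      (∀ (j : Fin m) (i : Fin n),
        (∀ i' : Fin n, smoothValue A p B i' j ≤ smoothValue A p B i j) →
        A i j = 1 → ¬ MixedBundle A i (B.bundle i j)) := by
  obtain ⟨B₀, hB₀⟩ := Finite.exists_max (partitionValue A p)
  obtain ⟨B, hB, hmin⟩ := Set.exists_min_image
    {B : PartitionScheme n m | ∀ B', partitionValue A p B' ≤ partitionValue A p B}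
    PartitionScheme.totalBundleCard (Set.toFinite _) ⟨B₀, hB₀⟩
  refine ⟨B, hB, fun j i hmax hj hmixed => ?_⟩
  obtain ⟨-, k, hk, hk0⟩ := hmixed
  have hkj : k ≠ j := by
    rintro rfl
    simp [hj] at hk0
  have hA' : ∀ i j, A i j ∈ Set.Icc 0 1 := fun i j => by
    rcases hA i j with h | h <;> simp [h]
  exact (B.totalBundleCard_isolate_lt hk hkj).not_ge <| hmin _ fun B' =>
    (hB B').trans (partitionValue_le_isolate hA' hp B hj hmax)
end

section
/- Let (A, p) be a uniform instance with r = |A^+|/m and with at least one zero-column (|A^0| = m(1−r) > 0). Let B be a partition scheme that fully covers A^+ and in which every column of A^0 belongs to a mixed bundle in at most one row. Let M = Σ_{i=1}^n Σ_{mixed bundles b ∈ B_i} |{j ∈ b : A_{ij} = 1}| be the total number of appearances of one-columns in mixed bundles, and set ρ = M/|A^0|. Then v^B(A,p) ≤ r + (1−r)·ρ/(ρ+1). In particular, the optimal partition value is at most r + (1−r)·ρ/(ρ+1) where ρ is computed from an optimal structured scheme. -/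
open Finset

/-- The tangent-plane bound for the concave function `(x, z) ↦ z * (x / (x + z))` at `(a, c)`. -/
theorem mul_div_add_le_tangent {x z a c k : ℝ} (hx : 0 ≤ x) (hz : 0 ≤ z) (hk : 0 < k)
    (hxz : x + z ≤ k) (hac : 0 < a + c) :
    z * (x / k) ≤ (c / (a + c)) ^ 2 * x + (a / (a + c)) ^ 2 * z := by
  rw [div_pow, div_pow, ← mul_div_assoc, div_le_iff₀ hk, div_mul_eq_mul_div, div_mul_eq_mul_div,
    ← add_div, div_mul_eq_mul_div, le_div_iff₀ (by positivity)]
  have h : (c ^ 2 * x + a ^ 2 * z) * (x + z) ≤ (c ^ 2 * x + a ^ 2 * z) * k := by gcongr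
  nlinarith [sq_nonneg (x * c - z * a)]

section

variable {n m : ℕ} {A : Fin n → Fin m → ℝ}

theorem sum_eq_card_ones (hA : ∀ i j, A i j = 0 ∨ A i j = 1) (i : Fin n)
    (b : Finset (Fin m)) [DecidablePred fun j => A i j = 1] :
    ∑ j ∈ b, A i j = ((b.filter (fun j => A i j = 1)).card : ℝ) := by
  rw [Finset.card_filter]
  push_cast
  refine Finset.sum_congr rfl fun j _ => ?_
  rcases hA i j with h | h <;> simp [h]

theorem smoothValue_uniform (hm : 0 < m) (B : PartitionScheme n m) (i : Fin n) (j : Fin m) :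
    smoothValue A (fun _ => 1 / (m : ℝ)) B i j =
      (∑ l ∈ B.bundle i j, A i l) / ((B.bundle i j).card : ℝ) := by
  have hm' : (0 : ℝ) < m := by exact_mod_cast hm
  simp only [smoothValue]
  rw [← Finset.mul_sum, Finset.sum_const, nsmul_eq_mul, mul_comm _ (1 / (m : ℝ)),
    mul_div_mul_left _ _ (by positivity)]

theorem smoothValue_uniform_le_one (hm : 0 < m) (hA : ∀ i j, A i j = 0 ∨ A i j = 1)
    (B : PartitionScheme n m) (i : Fin n) (j : Fin m) :
    smoothValue A (fun _ => 1 / (m : ℝ)) B i j ≤ 1 := by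
  rw [smoothValue_uniform hm]
  refine div_le_one_of_le₀ ?_ (by positivity)
  rw [Finset.card_eq_sum_ones]
  push_cast
  refine Finset.sum_le_sum fun l _ => ?_
  rcases hA i l with h | h <;> simp [h]

theorem smoothValue_uniform_nonneg (hm : 0 < m) (hA : ∀ i j, A i j = 0 ∨ A i j = 1)
    (B : PartitionScheme n m) (i : Fin n) (j : Fin m) :
    0 ≤ smoothValue A (fun _ => 1 / (m : ℝ)) B i j := by
  rw [smoothValue_uniform hm]
  refine div_nonneg (Finset.sum_nonneg fun l _ => ?_) (by positivity)
  rcases hA i l with h | h <;> simp [h]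

theorem smoothValue_uniform_eq_zero (hm : 0 < m) (hA : ∀ i j, A i j = 0 ∨ A i j = 1)
    (B : PartitionScheme n m) {i : Fin n} {j : Fin m} (hj : A i j = 0)
    (hb : ¬ MixedBundle A i (B.bundle i j)) :
    smoothValue A (fun _ => 1 / (m : ℝ)) B i j = 0 := by
  rw [smoothValue_uniform hm, Finset.sum_eq_zero, zero_div]
  intro l hl
  exact (hA i l).resolve_right fun h => hb ⟨⟨l, hl, h⟩, j, B.mem_bundle i j, hj⟩

open scoped Classical in
theorem sum_smoothValue_mixed_le (hm : 0 < m) (hA : ∀ i j, A i j = 0 ∨ A i j = 1)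
    (B : PartitionScheme n m) (i : Fin n) (Z : Finset (Fin m)) (hZ : ∀ j ∈ Z, A i j = 0)
    {a c : ℝ} (hac : 0 < a + c) :
    ∑ j ∈ Z.filter (fun j => MixedBundle A i (B.bundle i j)),
        smoothValue A (fun _ => 1 / (m : ℝ)) B i j ≤
      (c / (a + c)) ^ 2 *
        ((∑ b ∈ (Finset.univ.image (B.bundle i)).filter (MixedBundle A i),
          (b.filter (fun j => A i j = 1)).card : ℕ) : ℝ) +
      (a / (a + c)) ^ 2 *
        ((Z.filter (fun j => MixedBundle A i (B.bundle i j))).card : ℝ) := by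
  set W := Z.filter (fun j => MixedBundle A i (B.bundle i j)) with hW
  set T := (Finset.univ.image (B.bundle i)).filter (MixedBundle A i) with hT
  have hmaps : ∀ j ∈ W, B.bundle i j ∈ T := fun j hj => by
    simp only [hT, Finset.mem_filter, Finset.mem_image, Finset.mem_univ, true_and]
    exact ⟨⟨j, rfl⟩, (Finset.mem_filter.mp hj).2⟩
  rw [← Finset.sum_fiberwise_of_maps_to hmaps, Finset.card_eq_sum_card_fiberwise hmaps]
  push_cast
  rw [Finset.mul_sum, Finset.mul_sum, ← Finset.sum_add_distrib]
  refine Finset.sum_le_sum fun b hb => ?_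
  have hsum : ∑ j ∈ W.filter (fun j => B.bundle i j = b),
      smoothValue A (fun _ => 1 / (m : ℝ)) B i j =
      ((W.filter (fun j => B.bundle i j = b)).card : ℝ) *
        (((b.filter (fun j => A i j = 1)).card : ℝ) / (b.card : ℝ)) := by
    rw [← nsmul_eq_mul, ← Finset.sum_const]
    refine Finset.sum_congr rfl fun j hj => ?_
    rw [smoothValue_uniform hm, (Finset.mem_filter.mp hj).2, sum_eq_card_ones hA]
  rw [hsum]
  obtain ⟨⟨l, hl, -⟩, -⟩ := (Finset.mem_filter.mp hb).2
  refine mul_div_add_le_tangent (by positivity) (by positivity)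
    (by exact_mod_cast Finset.card_pos.mpr ⟨l, hl⟩) ?_ hac
  have hdisj : Disjoint (b.filter (fun j => A i j = 1))
      (W.filter (fun j => B.bundle i j = b)) := by
    refine Finset.disjoint_left.mpr fun j h1 h2 => ?_
    have h0 := hZ j (Finset.mem_filter.mp (Finset.mem_filter.mp h2).1).1
    rw [(Finset.mem_filter.mp h1).2] at h0
    exact one_ne_zero h0
  have hsub : b.filter (fun j => A i j = 1) ∪ W.filter (fun j => B.bundle i j = b) ⊆ b := by
    refine Finset.union_subset (Finset.filter_subset _ _) fun j hj => ?_
    have h := B.mem_bundle i j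
    rwa [(Finset.mem_filter.mp hj).2] at h
  have h := Finset.card_le_card hsub
  rw [Finset.card_union_of_disjoint hdisj] at h
  exact_mod_cast h

open scoped Classical in
theorem sum_card_filter_mixed_le (B : PartitionScheme n m) (Z : Finset (Fin m))
    (honce : ∀ j ∈ Z, ∀ i i' : Fin n,
      MixedBundle A i (B.bundle i j) → MixedBundle A i' (B.bundle i' j) → i = i') :
    ∑ i, (Z.filter (fun j => MixedBundle A i (B.bundle i j))).card ≤ Z.card := by
  simp only [Finset.card_filter]
  rw [Finset.sum_comm, Finset.card_eq_sum_ones]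
  refine Finset.sum_le_sum fun j hj => ?_
  rw [← Finset.card_filter, Finset.card_le_one]
  intro i hi i' hi'
  exact honce j hj i i' (Finset.mem_filter.mp hi).2 (Finset.mem_filter.mp hi').2

open scoped Classical in
/-- Upper bound on the contribution of the zero-columns to the partition value. -/
theorem sum_iSup_smoothValue_zero_le (hm : 0 < m) (hA : ∀ i j, A i j = 0 ∨ A i j = 1)
    (B : PartitionScheme n m) (Z : Finset (Fin m)) (hZ : ∀ j ∈ Z, ∀ i, A i j = 0)
    (hne : Z.Nonempty)
    (honce : ∀ j ∈ Z, ∀ i i' : Fin n,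
      MixedBundle A i (B.bundle i j) → MixedBundle A i' (B.bundle i' j) → i = i') :
    ∑ j ∈ Z, ⨆ i, smoothValue A (fun _ => 1 / (m : ℝ)) B i j ≤
      (Z.card : ℝ) * (mixedOneAppearances A B : ℝ) /
        ((mixedOneAppearances A B : ℝ) + (Z.card : ℝ)) := by
  set M : ℝ := (mixedOneAppearances A B : ℝ) with hM
  set c : ℝ := (Z.card : ℝ) with hc
  have hc0 : 0 < c := by rw [hc]; exact_mod_cast hne.card_pos
  have hM0 : 0 ≤ M := by positivity
  have hMc : 0 < M + c := by positivity
  have hrow : ∀ j ∈ Z, ⨆ i, smoothValue A (fun _ => 1 / (m : ℝ)) B i j ≤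
      ∑ i, if MixedBundle A i (B.bundle i j) then
        smoothValue A (fun _ => 1 / (m : ℝ)) B i j else 0 := by
    intro j hj
    have hnonneg : ∀ i, 0 ≤ if MixedBundle A i (B.bundle i j) then
        smoothValue A (fun _ => 1 / (m : ℝ)) B i j else 0 := fun i => by
      split_ifs
      exacts [smoothValue_uniform_nonneg hm hA B i j, le_rfl]
    refine Real.iSup_le (fun i => ?_) (Finset.sum_nonneg fun i _ => hnonneg i)
    refine le_trans ?_ (Finset.single_le_sum (fun i _ => hnonneg i) (Finset.mem_univ i))
    split_ifs with h
    exacts [le_rfl, (smoothValue_uniform_eq_zero hm hA B (hZ j hj i) h).le]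
  calc ∑ j ∈ Z, ⨆ i, smoothValue A (fun _ => 1 / (m : ℝ)) B i j
      ≤ ∑ i, ∑ j ∈ Z.filter (fun j => MixedBundle A i (B.bundle i j)),
          smoothValue A (fun _ => 1 / (m : ℝ)) B i j := by
        simp only [Finset.sum_filter]
        rw [Finset.sum_comm]
        exact Finset.sum_le_sum hrow
    _ ≤ (c / (M + c)) ^ 2 * M + (M / (M + c)) ^ 2 *
          ((∑ i, (Z.filter (fun j => MixedBundle A i (B.bundle i j))).card : ℕ) : ℝ) := by
        refine (Finset.sum_le_sum fun i _ =>
          sum_smoothValue_mixed_le hm hA B i Z (fun j hj => hZ j hj i) hMc).trans_eq ?_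
        rw [Finset.sum_add_distrib, ← Finset.mul_sum, ← Finset.mul_sum, ← Nat.cast_sum,
          ← Nat.cast_sum]
        rfl
    _ ≤ (c / (M + c)) ^ 2 * M + (M / (M + c)) ^ 2 * c := by
        gcongr
        rw [hc]
        exact_mod_cast sum_card_filter_mixed_le B Z honce
    _ = c * M / (M + c) := by
        field_simp
        ring

end

/-- For a uniform instance with r = |A⁺|/m and at least one zero-column,
if B fully covers A⁺ and every zero-column lies in a mixed bundle in at most one row,
then with M the total number of appearances of one-columns in mixed bundles and
ρ = M/|A⁰|, the partition value of B is at most r + (1−r)·ρ/(ρ+1). -/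
theorem opt_upper_bound_rho {n m : ℕ} (hn : 0 < n) (hm : 0 < m)
    (A : Fin n → Fin m → ℝ) (hA : ∀ i j, A i j = 0 ∨ A i j = 1)
    (Plus Zero : Finset (Fin m))
    (hPlus : ∀ j, j ∈ Plus ↔ ∃ i, A i j = 1)
    (hZero : ∀ j, j ∈ Zero ↔ ∀ i, A i j = 0)
    (hZne : Zero.Nonempty)
    (B : PartitionScheme n m)
    (hcov : FullyCovers A B)
    (honce : ∀ j ∈ Zero, ∀ i i' : Fin n,
      MixedBundle A i (B.bundle i j) → MixedBundle A i' (B.bundle i' j) → i = i')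
    (r ρ : ℝ)
    (hr : r = (Plus.card : ℝ) / m)
    (hρ : ρ = (mixedOneAppearances A B : ℝ) / (Zero.card : ℝ)) :
    partitionValue A (fun _ => 1 / m) B ≤ r + (1 - r) * ρ / (ρ + 1) := by
  have hm' : (0 : ℝ) < m := by exact_mod_cast hm
  have hc : (0 : ℝ) < Zero.card := by exact_mod_cast hZne.card_pos
  have hZP : Zero = Plusᶜ := by
    ext j
    rw [Finset.mem_compl, hZero, hPlus, not_exists]
    exact forall_congr' fun i => by rcases hA i j with h | h <;> simp [h]
  have hcard : (Plus.card : ℝ) + Zero.card = m := by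
    rw [hZP]
    exact_mod_cast (Finset.card_add_card_compl Plus).trans (Fintype.card_fin m)
  have hplus : ∑ j ∈ Plus, ⨆ i, smoothValue A (fun _ => 1 / (m : ℝ)) B i j ≤ Plus.card := by
    rw [Finset.card_eq_sum_ones]
    push_cast
    exact Finset.sum_le_sum fun j _ =>
      Real.iSup_le (fun i => smoothValue_uniform_le_one hm hA B i j) zero_le_one
  have hzero := sum_iSup_smoothValue_zero_le hm hA B Zero (fun j => (hZero j).mp) hZne honce
  have hM : (0 : ℝ) ≤ mixedOneAppearances A B := by positivity
  have hMc : (0 : ℝ) < mixedOneAppearances A B + Zero.card := by positivity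
  have hrhs : r + (1 - r) * ρ / (ρ + 1) = 1 / m * ((Plus.card : ℝ) +
      Zero.card * mixedOneAppearances A B / (mixedOneAppearances A B + Zero.card)) := by
    have h1 : 1 - r = Zero.card / m := by
      rw [hr, ← hcard, eq_div_iff (by rw [hcard]; exact hm'.ne')]
      field_simp
      ring
    rw [h1, hr, hρ]
    field_simp
  rw [hrhs, partitionValue, ← Finset.mul_sum, ← Finset.sum_add_sum_compl Plus, ← hZP]
  gcongr
end
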